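/- (Second moment of the score along the OU process.) Let q be any probability measure on ℝ^d and let t > 0. Set σ_t² := 1 − e^{−2t} and define ρ_t(y) := ∫ (2πσ_t²)^{−d/2}·exp(−||y − e^{−t}x||²/(2σ_t²)) dq(x), the density of the Ornstein–Uhlenbeck law q_t (the law of e^{−t}X + √(1−e^{−2t})·Z with X ~ q, Z ~ N(0, I_d) independent). Then ρ_t is positive and differentiable, and ∫_{ℝ^d} ||∇ρ_t(y)/ρ_t(y)||²·ρ_t(y) dy ≤ d/(1 − e^{−2t}) = e^{2t}·d/(e^{2t} − 1); in particular, for 0 < t ≤ 1 this quantity is at most C·d/t for a universal constant C. -/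

import Mathlib

open MeasureTheory Real

/-- The density of the Ornstein–Uhlenbeck forward process at time `t` started from `q`:
the density of `e^{-t} X + sqrt(1 - e^{-2t}) Z` where `X ~ q` and `Z ~ N(0, I_d)`. -/
noncomputable def ouDensity {d : ℕ} (q : Measure (EuclideanSpace ℝ (Fin d))) (t : ℝ)
    (y : EuclideanSpace ℝ (Fin d)) : ℝ :=
  ∫ x, (2 * π * (1 - exp (-(2 * t)))) ^ (-(d : ℝ) / 2) *
      exp (-‖y - exp (-t) • x‖ ^ 2 / (2 * (1 - exp (-(2 * t))))) ∂q

/-- The centred Gaussian density with covariance `s • 1` on `ℝ^d`. -/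
noncomputable def heatKernel {d : ℕ} (s : ℝ) (u : EuclideanSpace ℝ (Fin d)) : ℝ :=
  (2 * π * s) ^ (-(d : ℝ) / 2) * exp (-‖u‖ ^ 2 / (2 * s))

section HeatKernel

variable {d : ℕ} {s : ℝ}

lemma heatKernel_pos (hs : 0 < s) (u : EuclideanSpace ℝ (Fin d)) : 0 < heatKernel s u := by
  unfold heatKernel; positivity

@[fun_prop]
lemma continuous_heatKernel : Continuous (heatKernel (d := d) s) := by
  unfold heatKernel; fun_prop

lemma heatKernel_le (hs : 0 < s) (u : EuclideanSpace ℝ (Fin d)) :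
    heatKernel s u ≤ (2 * π * s) ^ (-(d : ℝ) / 2) := by
  refine mul_le_of_le_one_right (by positivity) (exp_le_one_iff.2 ?_)
  rw [neg_div]
  exact neg_nonpos.2 (by positivity)

lemma heatKernel_mul_norm_sq_le (hs : 0 < s) (u : EuclideanSpace ℝ (Fin d)) :
    heatKernel s u * ‖u‖ ^ 2 ≤ (2 * π * s) ^ (-(d : ℝ) / 2) * (2 * s) := by
  unfold heatKernel
  rw [mul_assoc]
  refine mul_le_mul_of_nonneg_left ?_ (by positivity)
  rw [neg_div, exp_neg, inv_mul_le_iff₀ (exp_pos _), ← div_le_iff₀ (by positivity)]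
  linarith [add_one_le_exp (‖u‖ ^ 2 / (2 * s))]

lemma heatKernel_mul_norm_le (hs : 0 < s) (u : EuclideanSpace ℝ (Fin d)) :
    heatKernel s u * ‖u‖ ≤ (2 * π * s) ^ (-(d : ℝ) / 2) * (1 + 2 * s) := by
  have h : heatKernel s u * ‖u‖ ≤ heatKernel s u * (1 + ‖u‖ ^ 2) := by
    gcongr
    · exact (heatKernel_pos hs u).le
    · nlinarith [sq_nonneg (‖u‖ - 1), sq_nonneg ‖u‖]
  linarith [heatKernel_le hs u, heatKernel_mul_norm_sq_le hs u]

lemma hasGradientAt_heatKernel (u : EuclideanSpace ℝ (Fin d)) :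
    HasGradientAt (heatKernel s) ((-(heatKernel s u / s)) • u) u := by
  have h := ((((hasStrictFDerivAt_norm_sq u).hasFDerivAt.neg.mul_const
    (2 * s)⁻¹).exp).const_mul ((2 * π * s) ^ (-(d : ℝ) / 2)))
  rw [hasGradientAt_iff_hasFDerivAt]
  refine HasFDerivAt.congr_fderiv h ?_
  ext v
  simp [heatKernel, div_eq_mul_inv]
  ring

lemma integral_norm_sq_mul_exp_neg_mul_norm_sq (hd : 1 ≤ d) {b : ℝ} (hb : 0 < b) :
    ∫ u : EuclideanSpace ℝ (Fin d), ‖u‖ ^ 2 * exp (-b * ‖u‖ ^ 2) =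
      d / (2 * b) * ∫ u : EuclideanSpace ℝ (Fin d), exp (-b * ‖u‖ ^ 2) := by
  have : Nonempty (Fin d) := ⟨⟨0, hd⟩⟩
  have hd' : (1 : ℝ) ≤ d := by exact_mod_cast hd
  have radial (k : ℕ) : ∫ r in Set.Ioi (0 : ℝ), r ^ k * exp (-b * r ^ 2) =
      b ^ (-((k : ℝ) + 1) / 2) * (1 / 2) * Gamma (((k : ℝ) + 1) / 2) := by
    rw [← integral_rpow_mul_exp_neg_mul_rpow (p := 2) (q := k) (by norm_num)
      (by linarith [k.cast_nonneg (α := ℝ)]) hb]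
    simp
  rw [integral_fun_norm_addHaar volume (fun r ↦ r ^ 2 * exp (-b * r ^ 2)),
    integral_fun_norm_addHaar volume (fun r ↦ exp (-b * r ^ 2))]
  simp only [finrank_euclideanSpace, Fintype.card_fin, smul_eq_mul, nsmul_eq_mul, ← mul_assoc,
    ← pow_add, radial, Nat.cast_add, Nat.cast_sub hd]
  have hG : Gamma ((d - (1 : ℕ) + (2 : ℕ) + 1 : ℝ) / 2) = d / 2 * Gamma (d / 2) := by
    rw [← Gamma_add_one (by positivity)]
    congr 1
    push_cast
    ring
  have hB : b ^ (-(d - (1 : ℕ) + (2 : ℕ) + 1 : ℝ) / 2) = b ^ (-(d : ℝ) / 2) / b := by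
    rw [← rpow_sub_one hb.ne']
    congr 1
    push_cast
    ring
  rw [hG, hB]
  simp only [Nat.cast_one, sub_add_cancel]
  field_simp

lemma integral_heatKernel_mul_norm_sq (hd : 1 ≤ d) (hs : 0 < s) :
    ∫ u : EuclideanSpace ℝ (Fin d), heatKernel s u * ‖u‖ ^ 2 = d * s := by
  have hb : 0 < (2 * s)⁻¹ := by positivity
  have h (u : EuclideanSpace ℝ (Fin d)) : heatKernel s u * ‖u‖ ^ 2 =
      (2 * π * s) ^ (-(d : ℝ) / 2) * (‖u‖ ^ 2 * exp (-(2 * s)⁻¹ * ‖u‖ ^ 2)) := by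
    rw [heatKernel, show -‖u‖ ^ 2 / (2 * s) = -(2 * s)⁻¹ * ‖u‖ ^ 2 by ring]
    ring
  simp_rw [h]
  rw [integral_const_mul, integral_norm_sq_mul_exp_neg_mul_norm_sq hd hb,
    GaussianFourier.integral_rexp_neg_mul_sq_norm hb, finrank_euclideanSpace, Fintype.card_fin,
    show π / (2 * s)⁻¹ = 2 * π * s by field_simp, neg_div, rpow_neg (by positivity)]
  have : 0 < (2 * π * s) ^ ((d : ℝ) / 2) := by positivity
  field_simp

lemma integrable_heatKernel_mul_norm_sq (hd : 1 ≤ d) (hs : 0 < s) :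
    Integrable fun u : EuclideanSpace ℝ (Fin d) ↦ heatKernel s u * ‖u‖ ^ 2 := by
  refine Integrable.of_integral_ne_zero ?_
  rw [integral_heatKernel_mul_norm_sq hd hs]
  positivity

variable (q : Measure (EuclideanSpace ℝ (Fin d))) [IsProbabilityMeasure q] (a : ℝ)

lemma integrable_heatKernel_sub_smul (hs : 0 < s) (y : EuclideanSpace ℝ (Fin d)) :
    Integrable (fun x ↦ heatKernel s (y - a • x)) q := by
  refine .of_bound (by fun_prop) ((2 * π * s) ^ (-(d : ℝ) / 2)) (.of_forall fun x ↦ ?_)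
  rw [norm_of_nonneg (heatKernel_pos hs _).le]
  exact heatKernel_le hs _

lemma integrable_heatKernel_sub_smul_smul (hs : 0 < s) (y : EuclideanSpace ℝ (Fin d)) :
    Integrable (fun x ↦ heatKernel s (y - a • x) • (y - a • x)) q := by
  refine .of_bound (by fun_prop) ((2 * π * s) ^ (-(d : ℝ) / 2) * (1 + 2 * s))
    (.of_forall fun x ↦ ?_)
  rw [norm_smul, norm_of_nonneg (heatKernel_pos hs _).le]
  exact heatKernel_mul_norm_le hs _

lemma integrable_heatKernel_sub_smul_mul_norm_sq (hs : 0 < s) (y : EuclideanSpace ℝ (Fin d)) :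
    Integrable (fun x ↦ heatKernel s (y - a • x) * ‖y - a • x‖ ^ 2) q := by
  refine .of_bound (by fun_prop) ((2 * π * s) ^ (-(d : ℝ) / 2) * (2 * s)) (.of_forall fun x ↦ ?_)
  rw [norm_of_nonneg (mul_nonneg (heatKernel_pos hs _).le (sq_nonneg _))]
  exact heatKernel_mul_norm_sq_le hs _

lemma integral_heatKernel_sub_smul_pos (hs : 0 < s) (y : EuclideanSpace ℝ (Fin d)) :
    0 < ∫ x, heatKernel s (y - a • x) ∂q := by
  rw [integral_pos_iff_support_of_nonneg (fun x ↦ (heatKernel_pos hs _).le)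
    (integrable_heatKernel_sub_smul q a hs y)]
  have : Function.support (fun x ↦ heatKernel s (y - a • x)) = Set.univ :=
    Set.eq_univ_of_forall fun x ↦ (heatKernel_pos hs _).ne'
  simp [this]

lemma hasGradientAt_integral_heatKernel (hs : 0 < s) (y : EuclideanSpace ℝ (Fin d)) :
    HasGradientAt (fun y ↦ ∫ x, heatKernel s (y - a • x) ∂q)
      (-(s⁻¹ • ∫ x, heatKernel s (y - a • x) • (y - a • x) ∂q)) y := by
  let L := InnerProductSpace.toDual ℝ (EuclideanSpace ℝ (Fin d))
  have hL (y : EuclideanSpace ℝ (Fin d)) :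
      L (-(s⁻¹ • ∫ x, heatKernel s (y - a • x) • (y - a • x) ∂q)) =
        ∫ x, L ((-(heatKernel s (y - a • x) / s)) • (y - a • x)) ∂q := by
    rw [← integral_smul, ← integral_neg]
    refine Eq.trans (L.toContinuousLinearEquiv.integral_comp_comm _).symm ?_
    refine integral_congr_ae (.of_forall fun x ↦ congrArg L ?_)
    simp only [smul_smul, neg_smul, div_eq_inv_mul]
  rw [hasGradientAt_iff_hasFDerivAt]
  change HasFDerivAt _ (L _) y
  rw [hL]
  refine hasFDerivAt_integral_of_dominated_of_fderiv_le (s := Set.univ)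
    (F := fun y x ↦ heatKernel s (y - a • x))
    (F' := fun y x ↦ L ((-(heatKernel s (y - a • x) / s)) • (y - a • x)))
    (bound := fun _ ↦ s⁻¹ * ((2 * π * s) ^ (-(d : ℝ) / 2) * (1 + 2 * s)))
    Filter.univ_mem (.of_forall fun y ↦ ?_) (integrable_heatKernel_sub_smul q a hs y) ?_
    (.of_forall fun x y _ ↦ ?_) (integrable_const _) (.of_forall fun x y _ ↦ ?_)
  · exact (integrable_heatKernel_sub_smul q a hs y).aestronglyMeasurable
  · exact (L.continuous.comp (by fun_prop)).aestronglyMeasurable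
  · rw [L.norm_map, norm_smul, norm_neg, norm_div, norm_of_nonneg (heatKernel_pos hs _).le,
      norm_of_nonneg hs.le, div_eq_inv_mul, mul_assoc]
    exact mul_le_mul_of_nonneg_left (heatKernel_mul_norm_le hs _) (by positivity)
  · exact (hasGradientAt_heatKernel (y - a • x)).hasFDerivAt.comp y
      ((hasFDerivAt_id y).sub_const (a • x))

/-- Jensen's inequality for the score of a Gaussian mixture, at a fixed point. -/
lemma norm_score_sq_mul_le (hs : 0 < s) (y : EuclideanSpace ℝ (Fin d)) :
    ‖(∫ x, heatKernel s (y - a • x) ∂q)⁻¹ •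
        gradient (fun y ↦ ∫ x, heatKernel s (y - a • x) ∂q) y‖ ^ 2 *
        ∫ x, heatKernel s (y - a • x) ∂q ≤
      (s ^ 2)⁻¹ * ∫ x, heatKernel s (y - a • x) * ‖y - a • x‖ ^ 2 ∂q := by
  have hR := integral_heatKernel_sub_smul_pos q a hs y
  have hk := integrable_heatKernel_sub_smul q a hs y
  have hv := integrable_heatKernel_sub_smul_smul q a hs y
  have hw := integrable_heatKernel_sub_smul_mul_norm_sq q a hs y
  rw [(hasGradientAt_integral_heatKernel q a hs y).gradient]
  set R := ∫ x, heatKernel s (y - a • x) ∂q with hRdef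
  set w := ∫ x, heatKernel s (y - a • x) • (y - a • x) ∂q with hwdef
  have hin := hv.const_inner (𝕜 := ℝ) (R⁻¹ • w)
  have key : 2 * inner ℝ (R⁻¹ • w) w - ‖R⁻¹ • w‖ ^ 2 * R ≤
      ∫ x, heatKernel s (y - a • x) * ‖y - a • x‖ ^ 2 ∂q := by
    rw [hwdef, ← integral_inner hv, ← hwdef, hRdef, ← integral_const_mul, ← integral_const_mul,
      ← hRdef, ← integral_sub (hin.const_mul 2) (hk.const_mul _)]
    refine integral_mono ((hin.const_mul 2).sub (hk.const_mul _)) hw fun x ↦ ?_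
    have h := norm_sub_sq_real (R⁻¹ • w) (y - a • x)
    have := mul_nonneg (heatKernel_pos hs (y - a • x)).le (sq_nonneg ‖R⁻¹ • w - (y - a • x)‖)
    rw [h] at this
    simp only [inner_smul_right]
    linarith
  have hLHS : ‖R⁻¹ • -(s⁻¹ • w)‖ ^ 2 * R =
      (s ^ 2)⁻¹ * (2 * inner ℝ (R⁻¹ • w) w - ‖R⁻¹ • w‖ ^ 2 * R) := by
    rw [inner_smul_left, real_inner_self_eq_norm_sq]
    simp only [norm_smul, norm_neg, norm_inv, norm_of_nonneg hR.le, norm_of_nonneg hs.le,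
      conj_trivial]
    field_simp
    ring
  rw [hLHS]
  gcongr

lemma integrable_prod_heatKernel_mul_norm_sq (hd : 1 ≤ d) (hs : 0 < s) :
    Integrable (fun p : EuclideanSpace ℝ (Fin d) × EuclideanSpace ℝ (Fin d) ↦
      heatKernel s (p.2 - a • p.1) * ‖p.2 - a • p.1‖ ^ 2) (q.prod volume) := by
  rw [integrable_prod_iff (by fun_prop)]
  refine ⟨.of_forall fun x ↦ (integrable_heatKernel_mul_norm_sq hd hs).comp_sub_right (a • x), ?_⟩
  have h (x : EuclideanSpace ℝ (Fin d)) :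
      ∫ y, ‖heatKernel s (y - a • x) * ‖y - a • x‖ ^ 2‖ =
        ∫ u : EuclideanSpace ℝ (Fin d), ‖heatKernel s u * ‖u‖ ^ 2‖ :=
    integral_sub_right_eq_self (fun u ↦ ‖heatKernel s u * ‖u‖ ^ 2‖) (a • x)
  simp only [h]
  exact integrable_const _

lemma integral_norm_score_sq_mul_le (hd : 1 ≤ d) (hs : 0 < s) :
    ∫ y, ‖(∫ x, heatKernel s (y - a • x) ∂q)⁻¹ •
        gradient (fun y ↦ ∫ x, heatKernel s (y - a • x) ∂q) y‖ ^ 2 *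
        ∫ x, heatKernel s (y - a • x) ∂q ≤ d / s := by
  have hint := integrable_prod_heatKernel_mul_norm_sq q a hd hs
  calc
    _ ≤ ∫ y, (s ^ 2)⁻¹ * ∫ x, heatKernel s (y - a • x) * ‖y - a • x‖ ^ 2 ∂q :=
      integral_mono_of_nonneg
        (.of_forall fun y ↦
          mul_nonneg (sq_nonneg _) (integral_heatKernel_sub_smul_pos q a hs y).le)
        (hint.integral_prod_right.const_mul _)
        (.of_forall fun y ↦ norm_score_sq_mul_le q a hs y)
    _ = (s ^ 2)⁻¹ * ∫ x, (∫ y, heatKernel s (y - a • x) * ‖y - a • x‖ ^ 2) ∂q := by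
      rw [integral_const_mul, ← integral_integral_swap hint]
    _ = d / s := by
      have h (x : EuclideanSpace ℝ (Fin d)) :
          ∫ y, heatKernel s (y - a • x) * ‖y - a • x‖ ^ 2 = d * s :=
        (integral_sub_right_eq_self (fun u ↦ heatKernel s u * ‖u‖ ^ 2) (a • x)).trans
          (integral_heatKernel_mul_norm_sq hd hs)
      simp only [h, integral_const, probReal_univ, one_smul]
      field_simp

end HeatKernel

lemma div_one_sub_exp_neg_two_mul_le {t : ℝ} (ht : 0 < t) (ht1 : t ≤ 1) {c : ℝ} (hc : 0 ≤ c) :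
    c / (1 - exp (-(2 * t))) ≤ 3 / 2 * c / t := by
  have h : exp (-(2 * t)) ≤ (1 + 2 * t)⁻¹ := by
    rw [exp_neg]
    gcongr
    linarith [add_one_le_exp (2 * t)]
  have h' : (1 + 2 * t)⁻¹ ≤ 1 - 2 / 3 * t := by
    rw [inv_le_iff_one_le_mul₀ (by positivity)]
    nlinarith
  calc
    c / (1 - exp (-(2 * t))) ≤ c / (2 / 3 * t) := by gcongr; linarith
    _ = 3 / 2 * c / t := by field_simp

/-- Second moment of the score along the OU process (Lemma `score_squared_norm_bound`):
`∫ ‖∇ρ_t/ρ_t‖² ρ_t ≤ d/(1 − e^{−2t})`, and for `0 < t ≤ 1` this is at most `C·d/t`. -/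
theorem ou_score_second_moment :
    ∃ C : ℝ, 0 < C ∧
      ∀ (d : ℕ), 1 ≤ d →
      ∀ (q : Measure (EuclideanSpace ℝ (Fin d))), IsProbabilityMeasure q →
      ∀ (t : ℝ), 0 < t →
        (∀ y, 0 < ouDensity q t y) ∧
        (∀ y, DifferentiableAt ℝ (ouDensity q t) y) ∧
        (∫ y, ‖(ouDensity q t y)⁻¹ • gradient (ouDensity q t) y‖ ^ 2 * ouDensity q t y
            ≤ d / (1 - exp (-(2 * t)))) ∧
        (t ≤ 1 →
          ∫ y, ‖(ouDensity q t y)⁻¹ • gradient (ouDensity q t) y‖ ^ 2 * ouDensity q t y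
            ≤ C * d / t) := by
  refine ⟨3 / 2, by norm_num, fun d hd q _ t ht ↦ ?_⟩
  have hs : 0 < 1 - exp (-(2 * t)) := by simpa using ht
  have hρ : ouDensity q t = fun y ↦ ∫ x, heatKernel (1 - exp (-(2 * t))) (y - exp (-t) • x) ∂q :=
    rfl
  have hbound := integral_norm_score_sq_mul_le q (exp (-t)) hd hs
  rw [hρ]
  exact ⟨integral_heatKernel_sub_smul_pos q _ hs,
    fun y ↦ (hasGradientAt_integral_heatKernel q _ hs y).differentiableAt,
    hbound, fun ht1 ↦ hbound.trans (div_one_sub_exp_neg_two_mul_le ht ht1 d.cast_nonneg)⟩
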